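/- arXiv:2402.12515 — 3 statements merged into one kernel-verified Lean document; each statement's English description precedes it below -/
import Mathlib

section
/- Let n be even, A a symmetric n×n real matrix with zero diagonal, σ* = (1,…,1,−1,…,−1) balanced, C₊ = {1,…,n/2}, C₋ = {n/2+1,…,n}, and f_A(σ) = Σ_{u,v} A_{uv} σᵤ σᵥ. If there exists σ̂ ∈ Θₙ = {σ ∈ {±1}ⁿ : ⟨σ, 𝟙⟩ = 0} with f_A(σ̂) > f_A(σ*), then there exist S₊ ⊆ C₊ and S₋ ⊆ C₋ with 1 ≤ |S₊| = |S₋| ≤ n/4 such that d₊(S₊) + d₊(S₋) < d₋(S₊∖S₋) + d₋(S₋∖S₊), where d₊(S₊) = Σ_{i∈S₊, k∈C₊∖S₊} A_{ik}, d₊(S₋) = Σ_{j∈S₋, l∈C₋∖S₋} A_{jl}, d₋(S₊∖S₋) = Σ_{i∈S₊, j∈C₋∖S₋} A_{ij}, and d₋(S₋∖S₊) = Σ_{j∈S₋, i∈C₊∖S₊} A_{ij}. -/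
open Finset

/-- `f_A(σ) = Σ_{u,v} A_{uv} σ_u σ_v`. -/
noncomputable def fA {n : ℕ} (A : Matrix (Fin n) (Fin n) ℝ) (σ : Fin n → ℝ) : ℝ :=
  ∑ u : Fin n, ∑ v : Fin n, A u v * σ u * σ v

/-- A balanced labelling swaps as many vertices of the first half as of the second. -/
theorem card_swapped_eq (m : ℕ) (σ : Fin (2 * m) → ℝ) (hσ : ∀ u, σ u = 1 ∨ σ u = -1)
    (hsum : ∑ u, σ u = 0) :
    (univ.filter fun u : Fin (2 * m) => (u : ℕ) < m ∧ σ u = -1).card =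
      (univ.filter fun u : Fin (2 * m) => ¬ (u : ℕ) < m ∧ σ u = 1).card := by
  have hp : (univ.filter fun u : Fin (2 * m) => (u : ℕ) < m).card = m := by
    rw [Fin.card_filter_val_lt]
    omega
  have hq : (univ.filter fun u : Fin (2 * m) => ¬ (u : ℕ) < m).card = m := by
    have h := card_filter_add_card_filter_not (s := (univ : Finset (Fin (2 * m))))
      (fun u => (u : ℕ) < m)
    rw [hp, card_univ, Fintype.card_fin] at h
    omega
  have key : ∑ u, σ u =
      ((univ.filter fun u : Fin (2 * m) => (u : ℕ) < m).card : ℝ)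
      - (univ.filter fun u : Fin (2 * m) => ¬ (u : ℕ) < m).card
      - 2 * (univ.filter fun u : Fin (2 * m) => (u : ℕ) < m ∧ σ u = -1).card
      + 2 * (univ.filter fun u : Fin (2 * m) => ¬ (u : ℕ) < m ∧ σ u = 1).card := by
    simp only [card_filter, Nat.cast_sum, mul_sum, ← sum_sub_distrib, ← sum_add_distrib]
    refine sum_congr rfl fun u _ => ?_
    by_cases h : (u : ℕ) < m <;> rcases hσ u with h1 | h1 <;> simp [h, h1] <;> norm_num
  rw [hsum, hp, hq] at key
  have : ((univ.filter fun u : Fin (2 * m) => (u : ℕ) < m ∧ σ u = -1).card : ℝ) =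
      (univ.filter fun u : Fin (2 * m) => ¬ (u : ℕ) < m ∧ σ u = 1).card := by linarith
  exact_mod_cast this

/-- The change of `fA` under a relabelling is four times the weight gained by the swap. -/
theorem fA_sub_fA_eq (m : ℕ) (A : Matrix (Fin (2 * m)) (Fin (2 * m)) ℝ) (hsymm : A.IsSymm)
    (σs : Fin (2 * m) → ℝ) (hσs : ∀ u, σs u = if (u : ℕ) < m then 1 else -1)
    (σ : Fin (2 * m) → ℝ) (hσ : ∀ u, σ u = 1 ∨ σ u = -1) (Sp Sm : Finset (Fin (2 * m)))
    (hSp : Sp = univ.filter fun u : Fin (2 * m) => (u : ℕ) < m ∧ σ u = -1)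
    (hSm : Sm = univ.filter fun u : Fin (2 * m) => ¬ (u : ℕ) < m ∧ σ u = 1) :
    fA A σ - fA A σs = 4 * (
      ((∑ i ∈ Sp, ∑ j ∈ (univ.filter (fun v : Fin (2 * m) => ¬ (v : ℕ) < m)) \ Sm, A i j) +
      (∑ j ∈ Sm, ∑ i ∈ (univ.filter (fun v : Fin (2 * m) => (v : ℕ) < m)) \ Sp, A j i)) -
      ((∑ i ∈ Sp, ∑ k ∈ (univ.filter (fun v : Fin (2 * m) => (v : ℕ) < m)) \ Sp, A i k) +
      (∑ j ∈ Sm, ∑ l ∈ (univ.filter (fun v : Fin (2 * m) => ¬ (v : ℕ) < m)) \ Sm, A j l))) := by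
  have hP : (univ.filter (fun v : Fin (2 * m) => (v : ℕ) < m)) \ Sp =
      univ.filter fun u : Fin (2 * m) => (u : ℕ) < m ∧ σ u = 1 := by
    ext u
    rcases hσ u with h | h <;> simp [hSp, h] <;> norm_num
  have hM : (univ.filter (fun v : Fin (2 * m) => ¬ (v : ℕ) < m)) \ Sm =
      univ.filter fun u : Fin (2 * m) => ¬ (u : ℕ) < m ∧ σ u = -1 := by
    ext u
    rcases hσ u with h | h <;> simp [hSm, h] <;> norm_num
  rw [hP, hM, hSp, hSm]
  have hcut : fA A σ - fA A σs =
      4 * ∑ u, ∑ v, A u v * ((σ u - σs u) * (σ v + σs v) / 4) := by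
    have hswap : ∑ u, ∑ v, A u v * (σ u * σs v) = ∑ u, ∑ v, A u v * (σs u * σ v) := by
      rw [sum_comm]
      refine sum_congr rfl fun u _ => sum_congr rfl fun v _ => ?_
      rw [hsymm.apply u v]
      ring
    have hexp : 4 * ∑ u, ∑ v, A u v * ((σ u - σs u) * (σ v + σs v) / 4) =
        fA A σ - fA A σs +
          (∑ u, ∑ v, A u v * (σ u * σs v) - ∑ u, ∑ v, A u v * (σs u * σ v)) := by
      simp only [fA, mul_sum, ← sum_sub_distrib, ← sum_add_distrib]
      exact sum_congr rfl fun u _ => sum_congr rfl fun v _ => by ring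
    rw [hexp, hswap, sub_self, add_zero]
  rw [hcut]
  congr 1
  simp only [sum_filter, ← sum_sub_distrib, ← sum_add_distrib]
  refine sum_congr rfl fun u _ => ?_
  by_cases hu : (u : ℕ) < m <;> rcases hσ u with h1 | h1 <;>
    have h2 : (1 : ℝ) ≠ -1 := by norm_num
  all_goals
    have h3 := h2.symm
    simp only [hσs u, hu, h1, h2, h3, and_true, and_false, if_true, if_false, not_true_eq_false,
      not_false_eq_true, ← sum_sub_distrib, add_zero,
      zero_add, sub_self, zero_mul, zero_div, mul_zero, sum_const_zero]
  all_goals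
    refine sum_congr rfl fun v _ => ?_
    by_cases hv : (v : ℕ) < m <;> rcases hσ v with h4 | h4 <;>
      simp [hσs v, hv, h4, h2, h3] <;> ring

/-- **A better balanced labelling produces a profitable pair of swap sets.**
For a symmetric matrix `A` with zero diagonal on `n = 2m` vertices and
`σ* = (1,…,1,−1,…,−1)`: if some balanced `±1` labelling `σ̂` has `f_A(σ̂) > f_A(σ*)`, then
there are `S₊ ⊆ C₊`, `S₋ ⊆ C₋` with `1 ≤ |S₊| = |S₋| ≤ n/4` and
`d₊(S₊) + d₊(S₋) < d₋(S₊∖S₋) + d₋(S₋∖S₊)`. -/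
theorem swap_sets_of_better_labelling (m : ℕ) (A : Matrix (Fin (2 * m)) (Fin (2 * m)) ℝ)
    (hsymm : A.IsSymm) (hdiag : ∀ u, A u u = 0)
    (σs : Fin (2 * m) → ℝ) (hσs : ∀ u, σs u = if (u : ℕ) < m then 1 else -1)
    (hbetter : ∃ σh : Fin (2 * m) → ℝ,
      (∀ u, σh u = 1 ∨ σh u = -1) ∧ (∑ u, σh u = 0) ∧ fA A σs < fA A σh) :
    ∃ Sp Sm : Finset (Fin (2 * m)),
      (∀ i ∈ Sp, (i : ℕ) < m) ∧ (∀ j ∈ Sm, m ≤ (j : ℕ)) ∧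
      1 ≤ Sp.card ∧ Sp.card = Sm.card ∧ 4 * Sp.card ≤ 2 * m ∧
      (∑ i ∈ Sp, ∑ k ∈ (univ.filter (fun v : Fin (2 * m) => (v : ℕ) < m)) \ Sp, A i k) +
      (∑ j ∈ Sm, ∑ l ∈ (univ.filter (fun v : Fin (2 * m) => ¬ (v : ℕ) < m)) \ Sm, A j l) <
      (∑ i ∈ Sp, ∑ j ∈ (univ.filter (fun v : Fin (2 * m) => ¬ (v : ℕ) < m)) \ Sm, A i j) +
      (∑ j ∈ Sm, ∑ i ∈ (univ.filter (fun v : Fin (2 * m) => (v : ℕ) < m)) \ Sp, A j i) := by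
  obtain ⟨σh, hσh, hsum, hlt⟩ := hbetter
  have hm : (univ.filter fun u : Fin (2 * m) => (u : ℕ) < m ∧ σh u = -1).card +
      (univ.filter fun u : Fin (2 * m) => (u : ℕ) < m ∧ (-σh) u = -1).card = m := by
    have hp : (univ.filter fun u : Fin (2 * m) => (u : ℕ) < m).card = m := by
      rw [Fin.card_filter_val_lt]
      omega
    rw [← card_union_of_disjoint]
    · refine Eq.trans (congrArg card ?_) hp
      ext u
      rcases hσh u with h | h <;> simp [h] <;> tauto
    · rw [disjoint_filter]
      rintro u - ⟨-, h⟩ ⟨-, h'⟩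
      rw [Pi.neg_apply, h] at h'
      norm_num at h'
  obtain ⟨σ, hσ, hsum, hlt, hcard⟩ : ∃ σ : Fin (2 * m) → ℝ,
      (∀ u, σ u = 1 ∨ σ u = -1) ∧ (∑ u, σ u = 0) ∧ fA A σs < fA A σ ∧
      2 * (univ.filter fun u : Fin (2 * m) => (u : ℕ) < m ∧ σ u = -1).card ≤ m := by
    by_cases hc : 2 * (univ.filter fun u : Fin (2 * m) => (u : ℕ) < m ∧ σh u = -1).card ≤ m
    · exact ⟨σh, hσh, hsum, hlt, hc⟩
    · refine ⟨-σh, fun u => ?_, ?_, ?_, by omega⟩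
      · rcases hσh u with h | h <;> simp [h]
      · simp [hsum]
      · simpa [fA] using hlt
  have heq := card_swapped_eq m σ hσ hsum
  have hgain := fA_sub_fA_eq m A hsymm σs hσs σ hσ _ _ rfl rfl
  refine ⟨univ.filter fun u : Fin (2 * m) => (u : ℕ) < m ∧ σ u = -1,
    univ.filter fun u : Fin (2 * m) => ¬ (u : ℕ) < m ∧ σ u = 1,
    fun i hi => (mem_filter.1 hi).2.1, fun j hj => not_lt.1 (mem_filter.1 hj).2.1,
    ?_, heq, by omega, by linarith⟩
  by_contra h0
  have hp := card_eq_zero.1 (Nat.lt_one_iff.1 (not_le.1 h0))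
  have hq := card_eq_zero.1 (heq.symm.trans (card_eq_zero.2 hp))
  rw [hp, hq] at hgain
  simp only [sum_empty, add_zero, sub_self, mul_zero] at hgain
  linarith
end

section
/- Let A be a symmetric n×n real matrix and σ* ∈ {±1}ⁿ with ⟨σ*, 𝟙⟩ = 0. Suppose there exist a diagonal matrix D* = diag{d*ᵢ} with d*ᵢ ∈ ℝ and λ* ∈ ℝ such that S* = D* − A + λ*J satisfies: S* is positive semidefinite, the second smallest eigenvalue of S* is strictly positive, and S*σ* = 0. Then Y* = σ*(σ*)ᵀ is the unique maximizer of ⟨A, Y⟩ over the set {Y ∈ ℝⁿˣⁿ : Y positive semidefinite, Yᵢᵢ = 1 for all i, ⟨J, Y⟩ = 0}. -/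
open Matrix

/-- The trace inner product `⟨X, Y⟩ = Tr(Xᵀ Y)`. -/
noncomputable def mtip {n : ℕ} (X Y : Matrix (Fin n) (Fin n) ℝ) : ℝ := (Xᵀ * Y).trace

/-- The eigenvalues of a Hermitian (real symmetric) matrix, sorted in nondecreasing
order, as a list. -/
noncomputable def sortedEigenvalues {n : ℕ} {S : Matrix (Fin n) (Fin n) ℝ}
    (hS : S.IsHermitian) : List ℝ :=
  (Finset.univ.val.map hS.eigenvalues).sort (· ≤ ·)

/-- The second smallest eigenvalue (counted with multiplicity) of a Hermitian matrix. -/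
noncomputable def secondSmallestEigenvalue {n : ℕ} {S : Matrix (Fin n) (Fin n) ℝ}
    (hS : S.IsHermitian) : ℝ :=
  (sortedEigenvalues hS).getD 1 0

/-- If the second smallest eigenvalue is positive, at most one eigenvalue vanishes. -/
theorem count_zero_eigenvalues_le_one {n : ℕ} {S : Matrix (Fin n) (Fin n) ℝ}
    (hS : S.IsHermitian) (hgap : 0 < secondSmallestEigenvalue hS) :
    (Finset.univ.val.map hS.eigenvalues).count 0 ≤ 1 := by
  have hsort : (sortedEigenvalues hS).Pairwise (· ≤ ·) := Multiset.pairwise_sort _ _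
  have hcoe : (sortedEigenvalues hS : Multiset ℝ) = Finset.univ.val.map hS.eigenvalues :=
    Multiset.sort_eq _ _
  rw [← hcoe, Multiset.coe_count]
  unfold secondSmallestEigenvalue at hgap
  match hl : sortedEigenvalues hS with
  | [] => simp
  | [a] => exact List.count_le_length
  | a :: b :: t =>
    rw [hl] at hsort hgap
    have hb : 0 < b := by simpa using hgap
    have htail : (b :: t).count 0 = 0 := by
      rw [List.count_eq_zero]
      intro hmem
      rcases List.mem_cons.1 hmem with h | h
      · exact hb.ne h
      · exact hb.not_ge ((List.pairwise_cons.1 (List.pairwise_cons.1 hsort).2).1 0 h)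
    rw [List.count_cons, htail]
    split_ifs <;> simp

/-- If the second smallest eigenvalue is positive, the kernel is spanned by any of its
nonzero vectors. -/
theorem exists_eq_smul_of_mulVec_eq_zero {n : ℕ} {S : Matrix (Fin n) (Fin n) ℝ}
    (hS : S.IsHermitian) (hgap : 0 < secondSmallestEigenvalue hS) {v w : Fin n → ℝ}
    (hv : S *ᵥ v = 0) (hv0 : v ≠ 0) (hw : S *ᵥ w = 0) : ∃ c : ℝ, w = c • v := by
  have hcount := count_zero_eigenvalues_le_one hS hgap
  have hcard : Fintype.card {i // hS.eigenvalues i = 0} ≤ 1 := by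
    rw [Multiset.count_map] at hcount
    rw [Fintype.card_subtype]
    simpa [Finset.card_def, eq_comm] using hcount
  have hker : Module.finrank ℝ (LinearMap.ker S.mulVecLin) ≤ 1 := by
    have hrank := hS.rank_eq_card_non_zero_eigs
    have hnull := S.mulVecLin.finrank_range_add_finrank_ker
    have hcompl := Fintype.card_subtype_compl fun i => hS.eigenvalues i = 0
    have hle := Fintype.card_subtype_le fun i => hS.eigenvalues i = 0
    rw [Matrix.rank] at hrank
    simp only [Module.finrank_fin_fun, Fintype.card_fin] at hnull hcompl hle
    simp only [ne_eq] at hrank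
    omega
  obtain ⟨u, hu⟩ := finrank_le_one_iff.1 hker
  obtain ⟨a, ha⟩ := hu ⟨v, by simpa using hv⟩
  obtain ⟨b, hb⟩ := hu ⟨w, by simpa using hw⟩
  have ha' : a • (u : Fin n → ℝ) = v := congrArg Subtype.val ha
  have hb' : b • (u : Fin n → ℝ) = w := congrArg Subtype.val hb
  have ha0 : a ≠ 0 := by
    rintro rfl
    exact hv0 (by simpa using ha'.symm)
  exact ⟨b / a, by rw [← ha', ← hb', smul_smul, div_mul_cancel₀ _ ha0]⟩

theorem trace_mul_vecMulVec_self {n : ℕ} (S : Matrix (Fin n) (Fin n) ℝ) (v : Fin n → ℝ) :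
    (S * vecMulVec v v).trace = v ⬝ᵥ S *ᵥ v := by
  rw [mul_vecMulVec, trace_vecMulVec, dotProduct_comm]

/-- A positive semidefinite `Y` has nonnegative trace inner product with a positive
semidefinite `S`; if `S` has positive second smallest eigenvalue and kills `v ≠ 0`, then the
product vanishes only when `Y` is a multiple of `v vᵀ`. -/
theorem trace_mul_nonneg_and_eq_smul {n : ℕ} {S Y : Matrix (Fin n) (Fin n) ℝ}
    (hS : S.PosSemidef) (hgap : 0 < secondSmallestEigenvalue hS.isHermitian)
    {v : Fin n → ℝ} (hv : S *ᵥ v = 0) (hv0 : v ≠ 0) (hY : Y.PosSemidef) :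
    0 ≤ (S * Y).trace ∧ ((S * Y).trace = 0 → ∃ c : ℝ, Y = c • vecMulVec v v) := by
  obtain ⟨m, w, rfl⟩ := posSemidef_iff_eq_sum_vecMulVec.1 hY
  simp only [star_trivial, Matrix.mul_sum, trace_sum, trace_mul_vecMulVec_self]
  have hnn : ∀ k, 0 ≤ w k ⬝ᵥ S *ᵥ w k := fun k => by
    simpa using hS.dotProduct_mulVec_nonneg (w k)
  refine ⟨Finset.sum_nonneg fun k _ => hnn k, fun h => ?_⟩
  have hzero := (Finset.sum_eq_zero_iff_of_nonneg fun k _ => hnn k).1 h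
  have hmul : ∀ k, ∃ c : ℝ, w k = c • v := fun k =>
    exists_eq_smul_of_mulVec_eq_zero hS.isHermitian hgap hv hv0
      ((hS.dotProduct_mulVec_zero_iff (w k)).1 (by simpa using hzero k (Finset.mem_univ k)))
  choose c hc using hmul
  refine ⟨∑ k, c k * c k, ?_⟩
  rw [Finset.sum_smul]
  refine Finset.sum_congr rfl fun k _ => ?_
  rw [hc k, smul_vecMulVec, vecMulVec_smul, smul_smul]

/-- On matrices with unit diagonal and `⟨J, Y⟩ = 0`, the dual slack pairs with `Y` as
`∑ dᵢ - ⟨A, Y⟩`. -/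
theorem trace_dual_slack_mul {n : ℕ} {A Y : Matrix (Fin n) (Fin n) ℝ} (hA : A.IsSymm)
    (d : Fin n → ℝ) (lam : ℝ) (hdiag : ∀ i, Y i i = 1)
    (hJ : mtip (Matrix.of fun _ _ => (1 : ℝ)) Y = 0) :
    ((Matrix.diagonal d - A + lam • Matrix.of (fun _ _ => (1 : ℝ))) * Y).trace =
      ∑ i, d i - mtip A Y := by
  have hJ' : ((Matrix.of fun _ _ => (1 : ℝ)) * Y).trace = 0 := hJ
  have hD : (Matrix.diagonal d * Y).trace = ∑ i, d i := by
    simp [Matrix.trace, hdiag]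
  rw [add_mul, sub_mul, trace_add, trace_sub, smul_mul, trace_smul, hJ', hD, mtip, hA.eq]
  simp

/-- **Deterministic dual certificate for the SDP relaxation in the GWSBM.**
If there are `D* = diag(d)` and `λ*` such that `S* = D* − A + λ*J` is PSD with
`λ₂(S*) > 0` and `S*σ* = 0`, then `Y* = σ*(σ*)ᵀ` is the unique maximizer of `⟨A, Y⟩`
over `{Y : Y ⪰ 0, Yᵢᵢ = 1 ∀i, ⟨J, Y⟩ = 0}`. -/
theorem sdp_dual_certificate (n : ℕ) (A : Matrix (Fin n) (Fin n) ℝ) (hA : A.IsSymm)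
    (σs : Fin n → ℝ) (hσ : ∀ i, σs i = 1 ∨ σs i = -1) (hbal : ∑ i, σs i = 0)
    (d : Fin n → ℝ) (lam : ℝ)
    (S : Matrix (Fin n) (Fin n) ℝ)
    (hS : S = Matrix.diagonal d - A + lam • Matrix.of (fun _ _ => (1 : ℝ)))
    (hPSD : S.PosSemidef)
    (hker : S.mulVec σs = 0)
    (hgap : 0 < secondSmallestEigenvalue hPSD.isHermitian) :
    ((vecMulVec σs σs).PosSemidef ∧ (∀ i, vecMulVec σs σs i i = 1) ∧
      mtip (Matrix.of fun _ _ => (1 : ℝ)) (vecMulVec σs σs) = 0) ∧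
    ∀ Y : Matrix (Fin n) (Fin n) ℝ,
      Y.PosSemidef → (∀ i, Y i i = 1) → mtip (Matrix.of fun _ _ => (1 : ℝ)) Y = 0 →
      Y ≠ vecMulVec σs σs → mtip A Y < mtip A (vecMulVec σs σs) := by
  have hsq : ∀ i, σs i * σs i = 1 := fun i => by
    rcases hσ i with h | h <;> simp [h]
  have hdiag : ∀ i, vecMulVec σs σs i i = 1 := hsq
  have hJ : mtip (Matrix.of fun _ _ => (1 : ℝ)) (vecMulVec σs σs) = 0 := by
    have hmul : (Matrix.of fun _ _ => (1 : ℝ) : Matrix (Fin n) (Fin n) ℝ)ᵀ *ᵥ σs = 0 := by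
      ext i
      simp [mulVec, dotProduct, hbal]
    rw [mtip, trace_mul_vecMulVec_self, hmul, dotProduct_zero]
  refine ⟨⟨by simpa using posSemidef_vecMulVec_self_star σs, hdiag, hJ⟩, ?_⟩
  intro Y hY hYdiag hYJ hne
  have hslack := trace_dual_slack_mul hA d lam hYdiag hYJ
  have hslackσ := trace_dual_slack_mul hA d lam hdiag hJ
  rw [← hS] at hslack hslackσ
  rw [trace_mul_vecMulVec_self, hker, dotProduct_zero] at hslackσ
  have hn : Nonempty (Fin n) := by
    by_contra hempty
    rw [not_nonempty_iff] at hempty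
    exact hne (Subsingleton.elim _ _)
  obtain ⟨i⟩ := hn
  have hσ0 : σs ≠ 0 := fun h => by simpa [h] using hsq i
  obtain ⟨hnn, heq⟩ := trace_mul_nonneg_and_eq_smul hPSD hgap hker hσ0 hY
  have hpos : (S * Y).trace ≠ 0 := fun h => by
    obtain ⟨c, hc⟩ := heq h
    have hc1 : c = 1 := by
      have := hYdiag i
      rwa [hc, Matrix.smul_apply, hdiag, smul_eq_mul, mul_one] at this
    exact hne (by rw [hc, hc1, one_smul])
  have := lt_of_le_of_ne hnn hpos.symm
  linarith
end

section
/- Let S* be a symmetric positive semidefinite n×n real matrix and σ* ∈ {±1}ⁿ such that S*σ* = 0 and the second smallest eigenvalue of S* is strictly positive (so the kernel of S* is spanned by σ*). If Y₂ is a positive semidefinite n×n matrix with Y₂ᵢᵢ = 1 for all i and ⟨S*, Y₂⟩ = 0 (trace inner product), then Y₂ = σ*(σ*)ᵀ. -/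
open Matrix

/-- If the entry at position one of a sorted list is positive, then at most one entry of the list
is nonpositive. -/
theorem countP_nonpos_le_one_of_sortedLE {l : List ℝ} (hl : l.Pairwise (· ≤ ·))
    (h : 0 < l.getD 1 0) : l.countP (· ≤ 0) ≤ 1 := by
  match l, hl, h with
  | [], _, h => simp at h
  | [a], _, h => simp at h
  | a :: b :: t, hl, h =>
    have hb : 0 < b := by simpa using h
    have ht : (b :: t).countP (· ≤ 0) = 0 := by
      rw [List.countP_eq_zero]
      intro x hx
      have hbx : b ≤ x := by
        rcases List.mem_cons.1 hx with rfl | hx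
        · exact le_rfl
        · exact List.rel_of_pairwise_cons (List.Pairwise.of_cons hl) hx
      simpa using hb.trans_le hbx
    rw [List.countP_cons, ht]
    split_ifs <;> simp

/-- A matrix with positive second smallest eigenvalue has at most one nonpositive eigenvalue. -/
theorem card_eigenvalues_nonpos_le_one {n : ℕ} {S : Matrix (Fin n) (Fin n) ℝ}
    (hS : S.IsHermitian) (h : 0 < secondSmallestEigenvalue hS) :
    Fintype.card {i // hS.eigenvalues i ≤ 0} ≤ 1 := by
  have h1 := countP_nonpos_le_one_of_sortedLE (Multiset.pairwise_sort _ _) h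
  rw [← Multiset.coe_countP, Multiset.sort_eq, Multiset.countP_map] at h1
  rw [Fintype.card_subtype]
  simpa [Finset.card_def] using h1

/-- A matrix with positive second smallest eigenvalue has kernel of dimension at most one. -/
theorem finrank_ker_mulVecLin_le_one {n : ℕ} {S : Matrix (Fin n) (Fin n) ℝ}
    (hS : S.IsHermitian) (h : 0 < secondSmallestEigenvalue hS) :
    Module.finrank ℝ (LinearMap.ker S.mulVecLin) ≤ 1 := by
  have h1 := card_eigenvalues_nonpos_le_one hS h
  have h2 := hS.rank_eq_card_non_zero_eigs
  have h3 := S.mulVecLin.finrank_range_add_finrank_ker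
  have h4 := Fintype.card_subtype_compl (fun i => hS.eigenvalues i = 0)
  have h5 := Fintype.card_subtype_mono (fun i => hS.eigenvalues i = 0)
    (fun i => hS.eigenvalues i ≤ 0) (fun _ hi => le_of_eq hi)
  have h6 := Fintype.card_subtype_le (fun i => hS.eigenvalues i = 0)
  rw [Matrix.rank] at h2
  simp only [Module.finrank_fintype_fun_eq_card, Fintype.card_fin, ne_eq] at *
  omega

open scoped MatrixOrder in
/-- Positive semidefinite matrices that are orthogonal for the trace inner product have
product zero. -/
theorem Matrix.PosSemidef.mul_eq_zero_of_trace_mul_eq_zero {m : Type*} [Fintype m]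
    {A B : Matrix m m ℝ} (hA : A.PosSemidef) (hB : B.PosSemidef) (h : (A * B).trace = 0) :
    A * B = 0 := by
  classical
  obtain ⟨C, rfl⟩ := CStarAlgebra.nonneg_iff_eq_star_mul_self.1 hA.nonneg
  obtain ⟨D, rfl⟩ := CStarAlgebra.nonneg_iff_eq_star_mul_self.1 hB.nonneg
  simp only [Matrix.star_eq_conjTranspose] at h ⊢
  have hCD : C * Dᴴ = 0 := by
    rw [← Matrix.trace_conjTranspose_mul_self_eq_zero_iff, Matrix.conjTranspose_mul,
      Matrix.conjTranspose_conjTranspose, ← h, Matrix.mul_assoc, Matrix.trace_mul_comm]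
    simp only [Matrix.mul_assoc]
  calc Cᴴ * C * (Dᴴ * D) = Cᴴ * (C * Dᴴ) * D := by simp only [Matrix.mul_assoc]
    _ = 0 := by rw [hCD, Matrix.mul_zero, Matrix.zero_mul]

/-- **Uniqueness from the kernel of the dual certificate.**
Let `S*` be PSD with `S*σ* = 0` and `λ₂(S*) > 0` (so `ker S* = span σ*`), where
`σ* ∈ {±1}ⁿ`. If `Y₂ ⪰ 0`, `Y₂ᵢᵢ = 1` for all `i`, and `⟨S*, Y₂⟩ = 0`, then
`Y₂ = σ*(σ*)ᵀ`. -/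
theorem kernel_uniqueness (n : ℕ) (S : Matrix (Fin n) (Fin n) ℝ)
    (hPSD : S.PosSemidef)
    (σs : Fin n → ℝ) (hσ : ∀ i, σs i = 1 ∨ σs i = -1)
    (hker : S.mulVec σs = 0)
    (hgap : 0 < secondSmallestEigenvalue hPSD.isHermitian)
    (Y₂ : Matrix (Fin n) (Fin n) ℝ) (hY₂ : Y₂.PosSemidef)
    (hdiag : ∀ i, Y₂ i i = 1)
    (horth : mtip S Y₂ = 0) :
    Y₂ = vecMulVec σs σs := by
  ext i j
  have hSY : S * Y₂ = 0 := by
    refine hPSD.mul_eq_zero_of_trace_mul_eq_zero hY₂ ?_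
    rwa [mtip, ← Matrix.conjTranspose_eq_transpose_of_trivial, hPSD.isHermitian.eq] at horth
  have hσ0 : ∀ k, σs k ≠ 0 := fun k => by rcases hσ k with h | h <;> simp [h]
  let v : LinearMap.ker S.mulVecLin := ⟨σs, by simpa using hker⟩
  have hv : v ≠ 0 := fun h => hσ0 i (congrFun (congrArg Subtype.val h) i)
  let y : LinearMap.ker S.mulVecLin := ⟨fun k => Y₂ k j, by
    ext k
    exact congrFun (congrFun hSY k) j⟩
  have : Nontrivial (LinearMap.ker S.mulVecLin) := ⟨v, 0, hv⟩
  have hfin : Module.finrank ℝ (LinearMap.ker S.mulVecLin) = 1 :=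
    le_antisymm (finrank_ker_mulVecLin_le_one hPSD.isHermitian hgap) Module.finrank_pos
  obtain ⟨c, hc⟩ := (finrank_eq_one_iff_of_nonzero' v hv).1 hfin y
  have hcol : ∀ k, c * σs k = Y₂ k j := fun k => congrFun (congrArg Subtype.val hc) k
  have hcj : c = σs j := by
    have h1 := hcol j
    rw [hdiag j] at h1
    rcases hσ j with h | h <;> rw [h] at h1 ⊢ <;> linarith
  rw [← hcol i, hcj, vecMulVec_apply, mul_comm]
end
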